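/- Fix a > 0 and k < 0. The suboptimality ratio r(b, k) := ((1 + k²)·b²)/(−2(a + b·k)(a + √(a² + b²))), viewed as a function of b on the domain D := { b > 0 : a + b·k < 0 } = (a/(−k), ∞), is quasiconvex (all its sublevel sets in b are convex), and there is at most one b ∈ D at which ∂r/∂b = 0; moreover, if such a stationary point exists then k < −1 and the stationary point equals b = 2ak/(1 − k²). -/

import Mathlib

theorem convexOn_sqrt_sq_add_sq (a : ℝ) :
    ConvexOn ℝ Set.univ fun b : ℝ => Real.sqrt (a ^ 2 + b ^ 2) := by
  refine ⟨convex_univ, fun x _ y _ α β hα hβ hαβ => ?_⟩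
  simp only [smul_eq_mul]
  have hx := Real.sq_sqrt (by positivity : 0 ≤ a ^ 2 + x ^ 2)
  have hy := Real.sq_sqrt (by positivity : 0 ≤ a ^ 2 + y ^ 2)
  have hxy : a ^ 2 + x * y ≤ Real.sqrt (a ^ 2 + x ^ 2) * Real.sqrt (a ^ 2 + y ^ 2) := by
    rw [← Real.sqrt_mul (by positivity)]
    apply Real.le_sqrt_of_sq_le
    nlinarith [sq_nonneg (a * (x - y))]
  apply Real.sqrt_le_iff.mpr ⟨by positivity, ?_⟩
  have hsq : a ^ 2 = (α + β) ^ 2 * a ^ 2 := by rw [hαβ]; ring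
  have hmul := mul_le_mul_of_nonneg_left hxy (mul_nonneg hα hβ)
  linear_combination 2 * hmul + hsq - α ^ 2 * hx - β ^ 2 * hy

/-- Rationalizing `b² / (a + √(a² + b²))` removes the square root from the denominator. -/
theorem suboptimality_ratio_eq {a : ℝ} (ha : 0 < a) (k b : ℝ) :
    ((1 + k ^ 2) * b ^ 2) / (-2 * (a + b * k) * (a + Real.sqrt (a ^ 2 + b ^ 2))) =
      ((1 + k ^ 2) * (Real.sqrt (a ^ 2 + b ^ 2) - a)) / (-2 * (a + b * k)) := by
  have hs := Real.sq_sqrt (by positivity : 0 ≤ a ^ 2 + b ^ 2)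
  have hpos : 0 < a + Real.sqrt (a ^ 2 + b ^ 2) := by positivity
  have hnum : (1 + k ^ 2) * b ^ 2 =
      (1 + k ^ 2) * (Real.sqrt (a ^ 2 + b ^ 2) - a) * (a + Real.sqrt (a ^ 2 + b ^ 2)) := by
    linear_combination (-(1 + k ^ 2)) * hs
  rw [hnum, mul_div_mul_right _ _ hpos.ne']

theorem stmt7 (a k : ℝ) (ha : 0 < a) (hk : k < 0) :
    let r : ℝ → ℝ := fun b =>
      ((1 + k^2) * b^2) / (-2 * (a + b * k) * (a + Real.sqrt (a^2 + b^2)))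
    QuasiconvexOn ℝ (Set.Ioi (a / (-k))) r ∧
    ∀ b ∈ Set.Ioi (a / (-k)), deriv r b = 0 →
      k < -1 ∧ b = 2 * a * k / (1 - k^2) := by
  intro r
  have hr : r = fun b =>
      ((1 + k ^ 2) * (Real.sqrt (a ^ 2 + b ^ 2) - a)) / (-2 * (a + b * k)) :=
    funext (suboptimality_ratio_eq ha k)
  have hden : ∀ b ∈ Set.Ioi (a / (-k)), 0 < -2 * (a + b * k) := by
    intro b hb
    have := (div_lt_iff₀ (neg_pos.mpr hk)).mp (Set.mem_Ioi.mp hb)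
    linarith
  rw [hr]
  constructor
  · intro c x hx y hy α β hα hβ hαβ
    obtain ⟨hxD, hxc⟩ := hx
    obtain ⟨hyD, hyc⟩ := hy
    have hzD := convex_Ioi (𝕜 := ℝ) (a / (-k)) hxD hyD hα hβ hαβ
    refine ⟨hzD, ?_⟩
    have hconv := (convexOn_sqrt_sq_add_sq a).2 (Set.mem_univ x) (Set.mem_univ y) hα hβ hαβ
    have hzden := hden _ hzD
    simp only [smul_eq_mul] at hconv hzden ⊢
    rw [div_le_iff₀ (hden x hxD)] at hxc
    rw [div_le_iff₀ (hden y hyD)] at hyc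
    rw [div_le_iff₀ hzden]
    have hC : 0 ≤ 1 + k ^ 2 := by positivity
    obtain rfl : β = 1 - α := by linarith
    linear_combination (1 + k ^ 2) * hconv + α * hxc + (1 - α) * hyc
  · intro b hb hderiv
    have hd := hden b hb
    have hb0 : 0 < b := (div_pos ha (neg_pos.mpr hk)).trans hb
    have hs := Real.sq_sqrt (by positivity : 0 ≤ a ^ 2 + b ^ 2)
    have hspos : 0 < Real.sqrt (a ^ 2 + b ^ 2) := by positivity
    have hsqrt := ((hasDerivAt_pow 2 b).const_add (a ^ 2)).sqrt (by positivity)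
    have hlin := (((hasDerivAt_id b).mul_const k).const_add a).const_mul (-2)
    have hquot := ((hsqrt.sub_const a).const_mul (1 + k ^ 2)).fun_div hlin hd.ne'
    have hzero := hquot.deriv.symm.trans hderiv
    simp only [id] at hzero
    rw [div_eq_zero_iff, or_iff_left (pow_ne_zero 2 hd.ne')] at hzero
    set s := Real.sqrt (a ^ 2 + b ^ 2)
    field_simp at hzero
    have hC : (1 + k ^ 2) ≠ 0 := by positivity
    have hcrit : -k * s = -k * a + b := by
      apply mul_left_cancel₀ (mul_ne_zero hC ha.ne')
      norm_num at hzero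
      rcases hzero with hzero | hzero
      · exact absurd hzero hC
      linear_combination (1 + k ^ 2) / 2 * hzero - (1 + k ^ 2) * k * hs
    have hstat : (k ^ 2 - 1) * b = -2 * k * a := by
      apply mul_right_cancel₀ hb0.ne'
      linear_combination (-k * s + (-k * a + b)) * hcrit - k ^ 2 * hs
    have hk1 : 0 < k ^ 2 - 1 := by
      apply pos_of_mul_pos_left _ hb0.le
      rw [hstat]
      nlinarith [mul_pos (neg_pos.mpr hk) ha]
    refine ⟨by nlinarith, ?_⟩
    rw [eq_div_iff (by linarith)]
    linear_combination -hstat
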